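/- There exist constants C>0 and h_0>0, depending only on k, α, β, γ, b-a and the quasi-uniformity constant c, such that whenever h ≤ h_0, u is (k+1)-times continuously differentiable with u(a)=u(b)=0, f := -αu''+βu'+γu, and u_h is a Petrov–Galerkin solution, then at every mesh node x_i, i=0,...,N: |(u-u_h)(x_i)| ≤ C h^{2(k-1)} |u|_{k+1,∞} and |(u-u_h)'(x_i)| ≤ C h^{2(k-1)} |u|_{k+1,∞}. -/

import Mathlib

open Set Finset intervalIntegral

/-- The Legendre polynomial of degree `n` (Rodrigues formula), as a real function. -/
noncomputable def legendre (n : ℕ) : ℝ → ℝ :=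
  fun s => (1 / ((2 : ℝ) ^ n * n.factorial)) * iteratedDeriv n (fun t : ℝ => (t ^ 2 - 1) ^ n) s

/-- The affine map sending `[-1,1]` onto `[p,q]`. -/
noncomputable def affMap (p q s : ℝ) : ℝ := (p + q) / 2 + s * (q - p) / 2

/-- `x 0 = a < x 1 < ... < x N = b` is a partition of `[a,b]`. -/
def IsMesh (a b : ℝ) (N : ℕ) (x : ℕ → ℝ) : Prop :=
  1 ≤ N ∧ x 0 = a ∧ x N = b ∧ ∀ i < N, x i < x (i + 1)

/-- `h` is the maximal element length `h = max_i (x i - x (i-1))`. -/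
def IsMeshSize (N : ℕ) (x : ℕ → ℝ) (h : ℝ) : Prop :=
  (∀ i ∈ Finset.Icc 1 N, x i - x (i - 1) ≤ h) ∧ ∃ i ∈ Finset.Icc 1 N, x i - x (i - 1) = h

/-- Quasi-uniformity with constant `c`: `h ≤ c · h_i` for all elements. -/
def IsQuasiUniform (N : ℕ) (x : ℕ → ℝ) (h c : ℝ) : Prop :=
  ∀ i ∈ Finset.Icc 1 N, h ≤ c * (x i - x (i - 1))

/-- `P i` are the element polynomials (degree ≤ k) of a member of `V_h^0`:
a C¹ piecewise polynomial vanishing at both ends of `[a,b]`. -/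
def IsVh0 (k N : ℕ) (x : ℕ → ℝ) (P : ℕ → Polynomial ℝ) : Prop :=
  (∀ i ∈ Finset.Icc 1 N, (P i).natDegree ≤ k) ∧
  (∀ i ∈ Finset.Icc 1 (N - 1), (P i).eval (x i) = (P (i + 1)).eval (x i)) ∧
  (∀ i ∈ Finset.Icc 1 (N - 1),
      (Polynomial.derivative (P i)).eval (x i) = (Polynomial.derivative (P (i + 1))).eval (x i)) ∧
  (P 1).eval (x 0) = 0 ∧ (P N).eval (x N) = 0

/-- `P i` are the element polynomials of a Petrov–Galerkin solution `u_h ∈ V_h^0`: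
`∑_i ∫_{τ_i} (-α u_h'' + β u_h' + γ u_h) v_h = ∫_a^b f v_h` for all `v_h ∈ W_h`. -/
def IsPGSol (k N : ℕ) (x : ℕ → ℝ) (α β γ : ℝ) (f : ℝ → ℝ) (P : ℕ → Polynomial ℝ) : Prop :=
  IsVh0 k N x P ∧
  ∀ Q : ℕ → Polynomial ℝ, (∀ i ∈ Finset.Icc 1 N, (Q i).natDegree ≤ k - 2) →
    (∑ i ∈ Finset.Icc 1 N, ∫ t in (x (i - 1))..(x i),
        (-α * ((Polynomial.derivative (Polynomial.derivative (P i))).eval t)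
            + β * ((Polynomial.derivative (P i)).eval t) + γ * (P i).eval t) * (Q i).eval t)
      = ∑ i ∈ Finset.Icc 1 N, ∫ t in (x (i - 1))..(x i), f t * (Q i).eval t

/-- `P i` are the element polynomials of a Gauss collocation solution `ū_h ∈ V_h^0`:
`(-α ū_h'' + β ū_h' + γ ū_h)(g) = f(g)` at every Gauss point `g` of every element. -/
def IsGaussSol (k N : ℕ) (x : ℕ → ℝ) (α β γ : ℝ) (f : ℝ → ℝ) (P : ℕ → Polynomial ℝ) : Prop :=
  IsVh0 k N x P ∧
  ∀ i ∈ Finset.Icc 1 N, ∀ s ∈ Set.Ioo (-1 : ℝ) 1, legendre (k - 1) s = 0 →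
    -α * ((Polynomial.derivative (Polynomial.derivative (P i))).eval (affMap (x (i - 1)) (x i) s))
        + β * ((Polynomial.derivative (P i)).eval (affMap (x (i - 1)) (x i) s))
        + γ * (P i).eval (affMap (x (i - 1)) (x i) s)
      = f (affMap (x (i - 1)) (x i) s)

/-- `p` is the elementwise truncated Jacobi projection of `u` on the element `[xl, xr]`:
the polynomial of degree ≤ k matching `u` and `u'` at both endpoints with
`(u - p)'' ⊥ P_{k-2}` in `L²(xl, xr)`. -/
def IsElemProj (k : ℕ) (u : ℝ → ℝ) (xl xr : ℝ) (p : Polynomial ℝ) : Prop :=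
  p.natDegree ≤ k ∧ p.eval xl = u xl ∧ p.eval xr = u xr ∧
  (Polynomial.derivative p).eval xl = deriv u xl ∧
  (Polynomial.derivative p).eval xr = deriv u xr ∧
  ∀ q : Polynomial ℝ, q.natDegree ≤ k - 2 →
    (∫ t in xl..xr,
        (iteratedDeriv 2 u t - (Polynomial.derivative (Polynomial.derivative p)).eval t)
          * q.eval t) = 0

/-- A function with finitely many `C²` pieces `e i` (with derivatives `e₁ i`, `e₂ i`) on a mesh,
which is `C¹` across the interior nodes and vanishes at both ends. -/
structure IsBrokenC2 (N : ℕ) (x : ℕ → ℝ) (e e₁ e₂ : ℕ → ℝ → ℝ) : Prop where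
  hasDerivAt : ∀ i t, HasDerivAt (e i) (e₁ i t) t
  hasDerivAt_deriv : ∀ i t, HasDerivAt (e₁ i) (e₂ i t) t
  continuous_deriv₂ : ∀ i, Continuous (e₂ i)
  value_match : ∀ i ∈ Finset.Icc 1 (N - 1), e i (x i) = e (i + 1) (x i)
  deriv_match : ∀ i ∈ Finset.Icc 1 (N - 1), e₁ i (x i) = e₁ (i + 1) (x i)
  left_zero : e 1 (x 0) = 0
  right_zero : e N (x N) = 0

/-- The bilinear concomitant of `-α v'' + β v' + γ v` and its adjoint. -/
def concomitant (α β v v₁ ψ ψ₁ : ℝ) : ℝ := -α * v₁ * ψ + α * v * ψ₁ + β * v * ψ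

/-- `ψ` solves the adjoint equation `-α ψ'' - β ψ' + γ ψ = 0`. -/
structure IsAdjointSol (α β γ : ℝ) (ψ : ℝ → ℝ) : Prop where
  contDiff : ContDiff ℝ (⊤ : ℕ∞) ψ
  eqn : ∀ t, -α * deriv (deriv ψ) t - β * deriv ψ t + γ * ψ t = 0

lemma deriv_exp_mul (r : ℝ) :
    deriv (fun t => Real.exp (r * t)) = fun t => r * Real.exp (r * t) := by
  funext t
  simpa [mul_comm] using (((hasDerivAt_id t).const_mul r).exp).deriv

lemma IsAdjointSol.exp {α β γ r : ℝ} (hr : -α * r ^ 2 - β * r + γ = 0) :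
    IsAdjointSol α β γ (fun t => Real.exp (r * t)) := by
  refine ⟨by fun_prop, fun t => ?_⟩
  have h2 : deriv (fun t => r * Real.exp (r * t)) t = r * (r * Real.exp (r * t)) := by
    rw [deriv_const_mul_field, deriv_exp_mul]
  rw [deriv_exp_mul, h2]
  linear_combination Real.exp (r * t) * hr

/-- Two adjoint solutions with nonvanishing Wronskian for which the homogeneous Dirichlet problem
on `[0, d]` is uniquely solvable. -/
lemma exists_adjoint_pair {α β γ d : ℝ} (hα : 0 < α) (hγ : 0 ≤ γ) (hd : 0 < d) :
    ∃ ψ φ : ℝ → ℝ, IsAdjointSol α β γ ψ ∧ IsAdjointSol α β γ φ ∧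
      (∀ t, ψ t * deriv φ t - φ t * deriv ψ t ≠ 0) ∧ ψ 0 * φ d - φ 0 * ψ d ≠ 0 := by
  have hdisc : 0 ≤ β ^ 2 + 4 * α * γ := by positivity
  set s := Real.sqrt (β ^ 2 + 4 * α * γ) with hs
  have hs2 : s ^ 2 = β ^ 2 + 4 * α * γ := Real.sq_sqrt hdisc
  have root : ∀ σ : ℝ, σ ^ 2 = s ^ 2 →
      -α * ((-β + σ) / (2 * α)) ^ 2 - β * ((-β + σ) / (2 * α)) + γ = 0 := by
    intro σ hσ
    field_simp
    nlinarith
  rcases eq_or_ne s 0 with h0 | h0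
  · have hsum : β ^ 2 + 4 * α * γ = 0 := by rw [← hs2, h0]; ring
    have hβ : β = 0 := by
      have : 0 ≤ 4 * α * γ := by positivity
      nlinarith [sq_nonneg β]
    have hγ0 : γ = 0 := by
      rw [hβ] at hsum
      have : α * γ = 0 := by linarith
      exact (mul_eq_zero.1 this).resolve_left hα.ne'
    subst hβ hγ0
    refine ⟨fun _ => 1, fun t => t, ⟨contDiff_const, fun t => by simp⟩, ⟨contDiff_id, fun t => ?_⟩,
      fun t => by simp, by simpa using hd.ne'⟩
    simp
  · have hne : (-β + s) / (2 * α) - (-β + -s) / (2 * α) ≠ 0 := by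
      have : (-β + s) / (2 * α) - (-β + -s) / (2 * α) = s / α := by field_simp; ring
      rw [this]
      positivity
    refine ⟨_, _, .exp (root s rfl), .exp (root (-s) (by ring)), fun t => ?_, ?_⟩
    · rw [deriv_exp_mul, deriv_exp_mul]
      intro h
      have h' : Real.exp ((-β + s) / (2 * α) * t) * Real.exp ((-β + -s) / (2 * α) * t) *
          ((-β + s) / (2 * α) - (-β + -s) / (2 * α)) = 0 := by linear_combination -h
      rcases mul_eq_zero.1 h' with h' | h'
      · exact absurd h' (by positivity)
      · exact hne h'
    · simp only [mul_zero, Real.exp_zero, one_mul]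
      intro h
      have := Real.exp_injective (sub_eq_zero.1 h)
      have h3 := mul_right_cancel₀ hd.ne' this
      exact hne (by linarith)

/-- Taylor approximation of a smooth function by polynomials on a short interval. -/
lemma exists_polynomial_approx {n : ℕ} {f : ℝ → ℝ} (hf : ContDiff ℝ (n + 1) f) {l r B : ℝ}
    (hlr : l < r) (hB : ∀ y ∈ Set.Icc l r, |iteratedDeriv (n + 1) f y| ≤ B) :
    ∃ q : Polynomial ℝ, q.natDegree ≤ n ∧
      ∀ t ∈ Set.Icc l r, |f t - q.eval t| ≤ B * (r - l) ^ (n + 1) := by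
  have hB0 : 0 ≤ B := (abs_nonneg _).trans (hB l ⟨le_rfl, hlr.le⟩)
  refine ⟨∑ j ∈ Finset.range (n + 1),
    Polynomial.C ((j.factorial : ℝ)⁻¹ * iteratedDerivWithin j f (Set.Icc l r) l) *
      (Polynomial.X - Polynomial.C l) ^ j, ?_, fun t ht => ?_⟩
  · refine Polynomial.natDegree_sum_le_of_forall_le _ _ fun j hj => ?_
    refine (Polynomial.natDegree_C_mul_le _ _).trans ?_
    rw [Polynomial.natDegree_pow, Polynomial.natDegree_X_sub_C, mul_one]
    exact Nat.lt_succ_iff.1 (Finset.mem_range.1 hj)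
  · have hT := taylor_mean_remainder_bound (C := B) hlr.le hf.contDiffOn ht (fun y hy => by
      rw [iteratedDerivWithin_eq_iteratedDeriv (uniqueDiffOn_Icc hlr) hf.contDiffAt hy]
      exact hB y hy)
    rw [taylor_within_apply, Real.norm_eq_abs] at hT
    have heval : (∑ j ∈ Finset.range (n + 1),
        Polynomial.C ((j.factorial : ℝ)⁻¹ * iteratedDerivWithin j f (Set.Icc l r) l) *
          (Polynomial.X - Polynomial.C l) ^ j).eval t = ∑ j ∈ Finset.range (n + 1),
        ((j.factorial : ℝ)⁻¹ * (t - l) ^ j) • iteratedDerivWithin j f (Set.Icc l r) l := by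
      rw [Polynomial.eval_finsetSum]
      refine Finset.sum_congr rfl fun j _ => ?_
      simp
      ring
    rw [heval]
    refine hT.trans ((div_le_self ?_ (by exact_mod_cast Nat.factorial_pos n)).trans ?_)
    · exact mul_nonneg hB0 (pow_nonneg (sub_nonneg.2 ht.1) _)
    · exact mul_le_mul_of_nonneg_left
        (pow_le_pow_left₀ (sub_nonneg.2 ht.1) (by linarith [ht.2]) _) hB0

/-- A mean-square bound on an interval bounds the mean of the absolute value. -/
lemma integral_abs_le_of_integral_sq_le {w : ℝ → ℝ} (hw : Continuous w) {l r ω : ℝ} (hlr : l < r)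
    (hω : 0 ≤ ω) (h : ∫ t in l..r, w t ^ 2 ≤ ω ^ 2 * (r - l)) :
    ∫ t in l..r, |w t| ≤ ω * (r - l) := by
  have hL : 0 < r - l := sub_pos.2 hlr
  set I := ∫ t in l..r, |w t| with hI
  set m := I / (r - l) with hm
  have h1 : 0 ≤ ∫ t in l..r, (|w t| - m) ^ 2 :=
    intervalIntegral.integral_nonneg hlr.le fun t _ => sq_nonneg _
  have h2 : ∫ t in l..r, (|w t| - m) ^ 2
      = (∫ t in l..r, w t ^ 2) - 2 * m * I + m ^ 2 * (r - l) := by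
    have : ∀ t, (|w t| - m) ^ 2 = w t ^ 2 - 2 * m * |w t| + m ^ 2 := fun t => by
      rw [← sq_abs (w t)]; ring
    simp_rw [this]
    rw [intervalIntegral.integral_add, intervalIntegral.integral_sub,
      intervalIntegral.integral_const_mul, intervalIntegral.integral_const, smul_eq_mul]
    · ring
    all_goals exact Continuous.intervalIntegrable (by fun_prop) _ _
  have hIm : I = m * (r - l) := by rw [hm]; field_simp
  have hsq : m ^ 2 ≤ ω ^ 2 := by
    rw [h2, hIm] at h1
    nlinarith
  rw [hIm]
  exact mul_le_mul_of_nonneg_right ((le_abs_self m).trans (abs_le_of_sq_le_sq hsq hω)) hL.le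

lemma IsMesh.pos_step {a b : ℝ} {N : ℕ} {x : ℕ → ℝ} (hm : IsMesh a b N x) {i : ℕ}
    (hi : i ∈ Finset.Icc 1 N) : x (i - 1) < x i := by
  rw [Finset.mem_Icc] at hi
  have := hm.2.2.2 (i - 1) (by omega)
  rwa [Nat.sub_add_cancel hi.1] at this

lemma IsMesh.mem_Icc {a b : ℝ} {N : ℕ} {x : ℕ → ℝ} (hm : IsMesh a b N x) {i : ℕ} (hi : i ≤ N) :
    x i ∈ Set.Icc a b := by
  obtain ⟨_, h0, hN, hlt⟩ := hm
  have mono : ∀ j, ∀ n, j + n ≤ N → x j ≤ x (j + n) := by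
    intro j n
    induction n with
    | zero => intro _; exact le_rfl
    | succ n ih => intro h; exact (ih (by omega)).trans (hlt (j + n) (by omega)).le
  constructor
  · have := mono 0 i (by omega)
    rwa [h0, Nat.zero_add] at this
  · have := mono i (N - i) (by omega)
    rwa [Nat.add_sub_cancel' hi, hN] at this

/-- Telescoping of elementwise increments of a function that is continuous across the nodes. -/
lemma abs_sub_le_of_increments {a b : ℝ} {N : ℕ} {x : ℕ → ℝ} (hm : IsMesh a b N x)
    {J : ℕ → ℝ → ℝ} {η : ℝ} (hJ : ∀ i ∈ Finset.Icc 1 (N - 1), J i (x i) = J (i + 1) (x i))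
    (hinc : ∀ i ∈ Finset.Icc 1 N, |J i (x i) - J i (x (i - 1))| ≤ η * (x i - x (i - 1))) :
    ∀ i ∈ Finset.Icc 1 N, |J i (x (i - 1)) - J 1 a| ≤ η * (x (i - 1) - a) := by
  intro i hi
  obtain ⟨h1, hN⟩ := Finset.mem_Icc.1 hi
  clear hi
  induction i, h1 using Nat.le_induction with
  | base => simp [hm.2.1]
  | succ i hi ih =>
    have h1 := ih (by omega)
    have h2 := hinc i (Finset.mem_Icc.2 ⟨hi, by omega⟩)
    rw [Nat.add_sub_cancel, ← hJ i (Finset.mem_Icc.2 ⟨hi, by omega⟩)]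
    calc |J i (x i) - J 1 a| ≤ |J i (x i) - J i (x (i - 1))| + |J i (x (i - 1)) - J 1 a| :=
          abs_sub_le _ _ _
      _ ≤ η * (x i - a) := by linarith

/-- Control of value and derivative by the concomitants with a pair of adjoint solutions. -/
lemma exists_concomitant_stability {α β γ d : ℝ} {ψ φ : ℝ → ℝ} (hα : 0 < α) (hd : 0 < d)
    (hψ : IsAdjointSol α β γ ψ) (hφ : IsAdjointSol α β γ φ)
    (hW : ∀ t, ψ t * deriv φ t - φ t * deriv ψ t ≠ 0) (hD : ψ 0 * φ d - φ 0 * ψ d ≠ 0) :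
    ∃ K > 0, ∀ t ∈ Set.Icc 0 d, ∀ v v₁ s z ε : ℝ,
      (∀ χ ∈ ({ψ, φ} : Set (ℝ → ℝ)),
        |concomitant α β v v₁ (χ t) (deriv χ t) - concomitant α β 0 s (χ 0) (deriv χ 0)| ≤ ε ∧
        |concomitant α β 0 z (χ d) (deriv χ d) - concomitant α β 0 s (χ 0) (deriv χ 0)| ≤ ε) →
      |v| ≤ K * ε ∧ |v₁| ≤ K * ε := by
  have hcψ := hψ.contDiff.continuous
  have hcφ := hφ.contDiff.continuous
  have hcψ' := hψ.contDiff.continuous_deriv (by simp)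
  have hcφ' := hφ.contDiff.continuous_deriv (by simp)
  obtain ⟨B, hB⟩ := (isCompact_Icc (a := (0 : ℝ)) (b := d)).exists_bound_of_continuousOn
    (f := fun t => (ψ t, deriv ψ t, φ t, deriv φ t, (ψ t * deriv φ t - φ t * deriv ψ t)⁻¹))
    (by
      have : Continuous fun t => (ψ t * deriv φ t - φ t * deriv ψ t)⁻¹ :=
        Continuous.inv₀ (by fun_prop) hW
      fun_prop)
  have hB' : ∀ t ∈ Set.Icc 0 d, |ψ t| ≤ B ∧ |deriv ψ t| ≤ B ∧ |φ t| ≤ B ∧ |deriv φ t| ≤ B ∧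
      |(ψ t * deriv φ t - φ t * deriv ψ t)⁻¹| ≤ B := fun t ht => by
    simpa [Prod.norm_def] using hB t ht
  have hB0 : 0 ≤ B := (abs_nonneg _).trans (hB' 0 ⟨le_rfl, hd.le⟩).1
  have two : ∀ p q y z m : ℝ, |p| ≤ B → |q| ≤ B → |y| ≤ m → |z| ≤ m →
      |p * y - q * z| ≤ 2 * B * m := fun p q y z m hp hq hy hz => by
    calc |p * y - q * z| ≤ |p * y| + |q * z| := abs_sub _ _
      _ = |p| * |y| + |q| * |z| := by rw [abs_mul, abs_mul]
      _ ≤ B * m + B * m := by gcongr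
      _ = 2 * B * m := by ring
  set D := ψ 0 * φ d - φ 0 * ψ d with hDdef
  have hDpos : 0 < |D| := abs_pos.2 hD
  set K₁ := 1 + 2 * B ^ 2 / |D| with hK₁
  have hK₁pos : 0 < K₁ := by positivity
  set K₂ := 2 * B ^ 2 * K₁ / α with hK₂
  have hK₂0 : 0 ≤ K₂ := by positivity
  refine ⟨K₂ + |β| / α * K₂ + 1, by positivity, fun t ht v v₁ s z ε hχ => ?_⟩
  obtain ⟨hψt, hψd⟩ := hχ ψ (by simp)
  obtain ⟨hφt, hφd⟩ := hχ φ (by simp)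
  obtain ⟨b1, b2, b3, b4, b5⟩ := hB' t ht
  have hε : 0 ≤ ε := (abs_nonneg _).trans hψt
  have hs : α * |s| ≤ 2 * B * ε / |D| := by
    rw [le_div_iff₀ hDpos]
    have := two (ψ d) (φ d) _ _ ε (hB' d ⟨hd.le, le_rfl⟩).1 (hB' d ⟨hd.le, le_rfl⟩).2.2.1 hφd hψd
    refine le_trans (le_of_eq ?_) this
    rw [← abs_of_pos hα, ← abs_mul, ← abs_mul, ← abs_neg, abs_of_pos hα, hDdef]
    congr 1
    simp only [concomitant]
    ring
  have hJ : ∀ χ ∈ ({ψ, φ} : Set (ℝ → ℝ)), |χ 0| ≤ B →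
      |concomitant α β v v₁ (χ t) (deriv χ t)| ≤ K₁ * ε := fun χ hmem hχ0 => by
    have h1 := (hχ χ hmem).1
    have h2 : |concomitant α β 0 s (χ 0) (deriv χ 0)| ≤ 2 * B * ε / |D| * B := by
      have : concomitant α β 0 s (χ 0) (deriv χ 0) = -(α * s * χ 0) := by
        simp only [concomitant]; ring
      rw [this, abs_neg, abs_mul, abs_mul, abs_of_pos hα]
      gcongr
    have h3 := abs_sub_abs_le_abs_sub (concomitant α β v v₁ (χ t) (deriv χ t))
      (concomitant α β 0 s (χ 0) (deriv χ 0))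
    have h4 : K₁ * ε = ε + 2 * B * ε / |D| * B := by rw [hK₁]; ring
    linarith
  have hJψ := hJ ψ (by simp) (hB' 0 ⟨le_rfl, hd.le⟩).1
  have hJφ := hJ φ (by simp) (hB' 0 ⟨le_rfl, hd.le⟩).2.2.1
  set W := ψ t * deriv φ t - φ t * deriv ψ t with hWdef
  have cancel : ∀ y m : ℝ, |y * W| ≤ m → |y| ≤ m * B := fun y m hy => by
    have h0 : 0 ≤ m := (abs_nonneg _).trans hy
    calc |y| = |y * W| * |W⁻¹| := by rw [← abs_mul, mul_assoc, mul_inv_cancel₀ (hW t), mul_one]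
      _ ≤ m * B := by gcongr
  have hv : |v| ≤ K₂ * ε := by
    have h1 := two _ _ _ _ _ b1 b3 hJφ hJψ
    have h2 := cancel (α * v) (2 * B * (K₁ * ε)) (by
      refine le_trans (le_of_eq ?_) h1
      congr 1
      simp only [concomitant, hWdef]
      ring)
    rw [abs_mul, abs_of_pos hα, ← le_div_iff₀' hα] at h2
    refine h2.trans (le_of_eq ?_)
    rw [hK₂]; ring
  have hv₁ : |v₁| ≤ K₂ * ε + |β| / α * (K₂ * ε) := by
    have h1 := two _ _ _ _ _ b2 b4 hJφ hJψ
    have h2 := cancel (α * v₁ - β * v) (2 * B * (K₁ * ε)) (by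
      refine le_trans (le_of_eq ?_) h1
      congr 1
      simp only [concomitant, hWdef]
      ring)
    have h3 : α * |v₁| ≤ 2 * B * (K₁ * ε) * B + |β| * (K₂ * ε) := by
      have h4 := abs_sub_abs_le_abs_sub (α * v₁) (β * v)
      rw [abs_mul, abs_mul, abs_of_pos hα] at h4
      have h5 : |β| * |v| ≤ |β| * (K₂ * ε) := by gcongr
      linarith
    rw [← le_div_iff₀' hα] at h3
    refine h3.trans (le_of_eq ?_)
    rw [hK₂]; field_simp
  have hnn : 0 ≤ |β| / α * K₂ * ε := by positivity
  have hnn' : 0 ≤ K₂ * ε := by positivity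
  constructor <;> nlinarith

/-- Lagrange's identity on one element. -/
lemma IsBrokenC2.concomitant_sub {α β γ a : ℝ} {N : ℕ} {x : ℕ → ℝ} {e e₁ e₂ : ℕ → ℝ → ℝ}
    {ψ : ℝ → ℝ} (he : IsBrokenC2 N x e e₁ e₂) (hψ : IsAdjointSol α β γ ψ) (i : ℕ) (l t : ℝ) :
    concomitant α β (e i t) (e₁ i t) (ψ (t - a)) (deriv ψ (t - a)) -
      concomitant α β (e i l) (e₁ i l) (ψ (l - a)) (deriv ψ (l - a)) =
    ∫ y in l..t, (-α * e₂ i y + β * e₁ i y + γ * e i y) * ψ (y - a) := by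
  have hce : Continuous (e i) :=
    continuous_iff_continuousAt.2 fun y => (he.hasDerivAt i y).continuousAt
  have hce₁ : Continuous (e₁ i) :=
    continuous_iff_continuousAt.2 fun y => (he.hasDerivAt_deriv i y).continuousAt
  have hce₂ := he.continuous_deriv₂ i
  have hcψ := hψ.contDiff.continuous
  rw [integral_eq_sub_of_hasDerivAt (f := fun y =>
    concomitant α β (e i y) (e₁ i y) (ψ (y - a)) (deriv ψ (y - a)))]
  · intro y _
    have hd1 : HasDerivAt (fun y => ψ (y - a)) (deriv ψ (y - a)) y :=
      ((hψ.contDiff.differentiable (by simp)) (y - a)).hasDerivAt.comp_sub_const y a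
    have hd2 : HasDerivAt (fun y => deriv ψ (y - a)) (deriv (deriv ψ) (y - a)) y :=
      ((contDiff_infty.1 hψ.contDiff 2).differentiable_deriv_two (y - a)).hasDerivAt.comp_sub_const y a
    have h0 := he.hasDerivAt i y
    have h1 := he.hasDerivAt_deriv i y
    have := (((h1.const_mul (-α)).mul hd1).add ((h0.const_mul α).mul hd2)).add
      ((h0.const_mul β).mul hd1)
    refine this.congr_deriv ?_
    linear_combination (-e i y) * hψ.eqn (y - a)
  · exact Continuous.intervalIntegrable (by fun_prop) _ _

/-- Weak elementwise moments of the residual against a pair of adjoint solutions control the value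
and the derivative of a broken `C²` function with homogeneous boundary values. -/
lemma exists_moment_stability {α β γ d : ℝ} {ψ φ : ℝ → ℝ} (hα : 0 < α) (hd : 0 < d)
    (hψ : IsAdjointSol α β γ ψ) (hφ : IsAdjointSol α β γ φ)
    (hW : ∀ t, ψ t * deriv φ t - φ t * deriv ψ t ≠ 0) (hD : ψ 0 * φ d - φ 0 * ψ d ≠ 0) :
    ∃ K > 0, ∀ (a b : ℝ), b - a = d → ∀ (N : ℕ) (x : ℕ → ℝ), IsMesh a b N x →
      ∀ e e₁ e₂ : ℕ → ℝ → ℝ, IsBrokenC2 N x e e₁ e₂ → ∀ η : ℝ,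
      (∀ χ ∈ ({ψ, φ} : Set (ℝ → ℝ)), ∀ i ∈ Finset.Icc 1 N,
        |∫ y in (x (i - 1))..(x i), (-α * e₂ i y + β * e₁ i y + γ * e i y) * χ (y - a)|
          ≤ η * (x i - x (i - 1))) →
      ∀ i ∈ Finset.Icc 1 N, ∀ t ∈ Set.Icc (x (i - 1)) (x i),
      (∀ χ ∈ ({ψ, φ} : Set (ℝ → ℝ)),
        |∫ y in (x (i - 1))..t, (-α * e₂ i y + β * e₁ i y + γ * e i y) * χ (y - a)|
          ≤ η * (x i - x (i - 1))) →
      |e i t| ≤ K * η ∧ |e₁ i t| ≤ K * η := by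
  obtain ⟨K, hK, hstab⟩ := exists_concomitant_stability hα hd hψ hφ hW hD
  refine ⟨K * d, by positivity, fun a b hab N x hm e e₁ e₂ he η hη i hi t ht hit => ?_⟩
  have h1N := hm.1
  have hNmem : N ∈ Finset.Icc 1 N := Finset.mem_Icc.2 ⟨h1N, le_rfl⟩
  obtain ⟨hi1, hiN⟩ := Finset.mem_Icc.1 hi
  have hη0 : 0 ≤ η := by
    have h1 := (abs_nonneg _).trans (hη ψ (by simp) i hi)
    exact nonneg_of_mul_nonneg_left h1 (sub_pos.2 (hm.pos_step hi))
  have hta : a ≤ t := (hm.mem_Icc (i := i - 1) (by omega)).1.trans ht.1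
  have htb : t ≤ b := ht.2.trans (hm.mem_Icc hiN).2
  have key : ∀ χ ∈ ({ψ, φ} : Set (ℝ → ℝ)), ∀ j ∈ Finset.Icc 1 N, ∀ y : ℝ,
      |∫ z in (x (j - 1))..y, (-α * e₂ j z + β * e₁ j z + γ * e j z) * χ (z - a)|
          ≤ η * (x j - x (j - 1)) →
      |concomitant α β (e j y) (e₁ j y) (χ (y - a)) (deriv χ (y - a)) -
        concomitant α β 0 (e₁ 1 a) (χ 0) (deriv χ 0)| ≤ η * d := by
    intro χ hmem j hj y hy
    have hχ : IsAdjointSol α β γ χ := by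
      rcases hmem with rfl | rfl
      exacts [hψ, hφ]
    have htel := abs_sub_le_of_increments hm (η := η) (J := fun j y =>
      concomitant α β (e j y) (e₁ j y) (χ (y - a)) (deriv χ (y - a)))
      (fun j hj => by simp only [he.value_match j hj, he.deriv_match j hj])
      (fun j hj => by
        rw [he.concomitant_sub hχ]
        exact hη χ hmem j hj) j hj
    have h0 : e 1 a = 0 := by simpa [hm.2.1] using he.left_zero
    rw [h0, sub_self] at htel
    rw [← he.concomitant_sub hχ] at hy
    have hjb := (hm.mem_Icc (Finset.mem_Icc.1 hj).2).2
    calc _ ≤ _ := abs_sub_le _ (concomitant α β (e j (x (j - 1))) (e₁ j (x (j - 1)))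
              (χ (x (j - 1) - a)) (deriv χ (x (j - 1) - a))) _
      _ ≤ η * (x j - x (j - 1)) + η * (x (j - 1) - a) := add_le_add hy htel
      _ = η * (x j - a) := by ring
      _ ≤ η * d := by gcongr; linarith
  have := hstab (t - a) ⟨by linarith, by linarith⟩ (e i t) (e₁ i t) (e₁ 1 a) (e₁ N b) (η * d)
    fun χ hmem => ⟨key χ hmem i hi t (hit χ hmem), by
      have h := key χ hmem N hNmem (x N) (hη χ hmem N hNmem)
      rwa [he.right_zero, hm.2.2.1, hab] at h⟩
  rwa [show K * d * η = K * (η * d) by ring]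

lemma integral_abs_mul_le {w f : ℝ → ℝ} (hw : Continuous w) (hf : Continuous f) {l r m : ℝ}
    (hlr : l ≤ r) (hm : ∀ t ∈ Set.Icc l r, |f t| ≤ m) :
    |∫ t in l..r, w t * f t| ≤ m * ∫ t in l..r, |w t| := by
  refine (abs_integral_le_integral_abs hlr).trans ?_
  rw [← intervalIntegral.integral_const_mul]
  refine intervalIntegral.integral_mono_on hlr (Continuous.intervalIntegrable (by fun_prop) _ _)
    (Continuous.intervalIntegrable (by fun_prop) _ _) fun t ht => ?_
  rw [abs_mul, mul_comm]
  exact mul_le_mul_of_nonneg_right (hm t ht) (abs_nonneg _)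

/-- A function orthogonal to `q` has mean square no larger than that of its difference to `q`. -/
lemma integral_sq_le_of_orthogonal {w q : ℝ → ℝ} (hw : Continuous w) (hq : Continuous q)
    {l r m : ℝ} (hlr : l ≤ r) (horth : ∫ t in l..r, w t * q t = 0)
    (hm : ∀ t ∈ Set.Icc l r, |w t - q t| ≤ m) :
    ∫ t in l..r, w t ^ 2 ≤ m ^ 2 * (r - l) := by
  have h1 : ∫ t in l..r, (w t - q t) ^ 2
      = (∫ t in l..r, w t ^ 2) - 2 * (∫ t in l..r, w t * q t) + ∫ t in l..r, q t ^ 2 := by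
    have : ∀ t, (w t - q t) ^ 2 = w t ^ 2 - 2 * (w t * q t) + q t ^ 2 := fun t => by ring
    simp_rw [this]
    rw [intervalIntegral.integral_add, intervalIntegral.integral_sub,
      intervalIntegral.integral_const_mul]
    all_goals exact Continuous.intervalIntegrable (by fun_prop) _ _
  have h2 : 0 ≤ ∫ t in l..r, q t ^ 2 :=
    intervalIntegral.integral_nonneg hlr fun t _ => sq_nonneg _
  have h3 : ∫ t in l..r, (w t - q t) ^ 2 ≤ ∫ _ in l..r, m ^ 2 := by
    refine intervalIntegral.integral_mono_on hlr (Continuous.intervalIntegrable (by fun_prop) _ _)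
      (Continuous.intervalIntegrable (by fun_prop) _ _) fun t ht => ?_
    exact sq_le_sq.2 ((hm t ht).trans (le_abs_self m))
  rw [intervalIntegral.integral_const, smul_eq_mul] at h3
  rw [horth] at h1
  linarith

/-- If the residual of `e` is elementwise orthogonal to polynomials of degree at most `n` and `e''`
is within `δ` of such polynomials, then on fine meshes the residual is bounded by `2 α δ` in mean. -/
lemma exists_residual_bound {α β γ d : ℝ} (hα : 0 < α) (hγ : 0 ≤ γ) (hd : 0 < d) :
    ∃ K > 0, ∀ (a b : ℝ), b - a = d → ∀ (N : ℕ) (x : ℕ → ℝ), IsMesh a b N x →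
      ∀ e e₁ e₂ : ℕ → ℝ → ℝ, IsBrokenC2 N x e e₁ e₂ → ∀ (n : ℕ) (δ h : ℝ),
      (∀ i ∈ Finset.Icc 1 N, ∀ q : Polynomial ℝ, q.natDegree ≤ n →
        ∫ y in (x (i - 1))..(x i), (-α * e₂ i y + β * e₁ i y + γ * e i y) * q.eval y = 0) →
      (∀ i ∈ Finset.Icc 1 N, ∃ q : Polynomial ℝ, q.natDegree ≤ n ∧
        ∀ t ∈ Set.Icc (x (i - 1)) (x i), |e₂ i t - q.eval t| ≤ δ) →
      (∀ i ∈ Finset.Icc 1 N, x i - x (i - 1) ≤ h) → K * h ≤ 1 / 2 →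
      ∀ i ∈ Finset.Icc 1 N,
        ∫ y in (x (i - 1))..(x i), |-α * e₂ i y + β * e₁ i y + γ * e i y|
          ≤ 2 * α * δ * (x i - x (i - 1)) := by
  obtain ⟨ψ, φ, hψ, hφ, hW, hD⟩ := exists_adjoint_pair (β := β) hα hγ hd
  obtain ⟨K, hK, hstab⟩ := exists_moment_stability hα hd hψ hφ hW hD
  obtain ⟨B, hB⟩ := (isCompact_Icc (a := (0 : ℝ)) (b := d)).exists_bound_of_continuousOn
    (f := fun t => (ψ t, φ t))
    (hψ.contDiff.continuous.prodMk hφ.contDiff.continuous).continuousOn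
  have hB' : ∀ χ ∈ ({ψ, φ} : Set (ℝ → ℝ)), Continuous χ ∧ ∀ t ∈ Set.Icc 0 d, |χ t| ≤ B := by
    intro χ hχ
    rcases hχ with rfl | rfl
    · exact ⟨hψ.contDiff.continuous, fun t ht => (norm_fst_le _).trans (hB t ht)⟩
    · exact ⟨hφ.contDiff.continuous, fun t ht => (norm_snd_le _).trans (hB t ht)⟩
  have hB0 : 0 ≤ B := (abs_nonneg _).trans ((hB' ψ (by simp)).2 0 ⟨le_rfl, hd.le⟩)
  set L := |β| / α * (|β| * (K * B) + γ * (K * B) + 1) + γ * (K * B) with hL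
  have hL0 : 0 ≤ L := by positivity
  refine ⟨L + 1, by positivity,
    fun a b hab N x hm e e₁ e₂ he n δ h horth happrox hh hKh => ?_⟩
  set w : ℕ → ℝ → ℝ := fun i y => -α * e₂ i y + β * e₁ i y + γ * e i y with hw
  have hce : ∀ i, Continuous (e i) := fun i =>
    continuous_iff_continuousAt.2 fun y => (he.hasDerivAt i y).continuousAt
  have hce₁ : ∀ i, Continuous (e₁ i) := fun i =>
    continuous_iff_continuousAt.2 fun y => (he.hasDerivAt_deriv i y).continuousAt
  have hce₂ := he.continuous_deriv₂
  have hcw : ∀ i, Continuous (w i) := fun i => by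
    have := hce i; have := hce₁ i; have := hce₂ i
    fun_prop
  obtain ⟨i₀, hi₀, hmax⟩ := Finset.exists_max_image (Finset.Icc 1 N)
    (fun i => (∫ y in (x (i - 1))..(x i), w i y ^ 2) / (x i - x (i - 1)))
    ⟨1, Finset.mem_Icc.2 ⟨le_rfl, hm.1⟩⟩
  set ω := Real.sqrt ((∫ y in (x (i₀ - 1))..(x i₀), w i₀ y ^ 2) / (x i₀ - x (i₀ - 1))) with hω
  have hstep : ∀ i ∈ Finset.Icc 1 N, 0 < x i - x (i - 1) := fun i hi => sub_pos.2 (hm.pos_step hi)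
  have hω0 : 0 ≤ ω := Real.sqrt_nonneg _
  have hω2 : ω ^ 2 = (∫ y in (x (i₀ - 1))..(x i₀), w i₀ y ^ 2) / (x i₀ - x (i₀ - 1)) :=
    Real.sq_sqrt (div_nonneg (intervalIntegral.integral_nonneg (hm.pos_step hi₀).le
      fun _ _ => sq_nonneg _) (hstep i₀ hi₀).le)
  have hmean : ∀ i ∈ Finset.Icc 1 N,
      ∫ y in (x (i - 1))..(x i), |w i y| ≤ ω * (x i - x (i - 1)) := fun i hi => by
    refine integral_abs_le_of_integral_sq_le (hcw i) (hm.pos_step hi) hω0 ?_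
    rw [hω2, ← div_le_iff₀ (hstep i hi)]
    exact hmax i hi
  have hmom : ∀ χ ∈ ({ψ, φ} : Set (ℝ → ℝ)), ∀ i ∈ Finset.Icc 1 N,
      ∀ t ∈ Set.Icc (x (i - 1)) (x i),
        |∫ y in (x (i - 1))..t, w i y * χ (y - a)| ≤ B * ω * (x i - x (i - 1)) := by
    intro χ hχ i hi t ht
    obtain ⟨hcχ, hχB⟩ := hB' χ hχ
    obtain ⟨hi1, hiN⟩ := Finset.mem_Icc.1 hi
    have hl := (hm.mem_Icc (i := i - 1) (by omega)).1
    have hr := (hm.mem_Icc hiN).2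
    have h1 := integral_abs_mul_le (hcw i) (f := fun y => χ (y - a)) (by fun_prop) ht.1 (m := B)
      fun y hy => hχB _ ⟨by linarith [hy.1], by linarith [hy.2, ht.2]⟩
    have h2 : ∫ y in (x (i - 1))..t, |w i y| ≤ ∫ y in (x (i - 1))..(x i), |w i y| :=
      intervalIntegral.integral_mono_interval le_rfl ht.1 ht.2
        (Filter.Eventually.of_forall fun _ => abs_nonneg _)
        ((hcw i).abs.intervalIntegrable _ _)
    calc _ ≤ _ := h1
      _ ≤ B * (ω * (x i - x (i - 1))) := by
        gcongr
        exact h2.trans (hmean i hi)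
      _ = _ := by ring
  have hpt : ∀ i ∈ Finset.Icc 1 N, ∀ t ∈ Set.Icc (x (i - 1)) (x i),
      |e i t| ≤ K * (B * ω) ∧ |e₁ i t| ≤ K * (B * ω) := fun i hi t ht =>
    hstab a b hab N x hm e e₁ e₂ he (B * ω)
      (fun χ hχ j hj => hmom χ hχ j hj (x j) ⟨(hm.pos_step hj).le, le_rfl⟩)
      i hi t ht (fun χ hχ => hmom χ hχ i hi t ht)
  have hosc : ∀ i ∈ Finset.Icc 1 N, ∀ t ∈ Set.Icc (x (i - 1)) (x i),
      |(β * e₁ i t + γ * e i t) - (β * e₁ i (x (i - 1)) + γ * e i (x (i - 1)))|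
        ≤ L * ω * (x i - x (i - 1)) := by
    intro i hi t ht
    have hcw' := hcw i
    have hc1 := hce i
    have hc2 := hce₁ i
    have hc3 := hce₂ i
    have hder : ∀ y, HasDerivAt (fun y => β * e₁ i y + γ * e i y) (β * e₂ i y + γ * e₁ i y) y :=
      fun y => ((he.hasDerivAt_deriv i y).const_mul β).add ((he.hasDerivAt i y).const_mul γ)
    rw [← integral_eq_sub_of_hasDerivAt (fun y _ => hder y)
      (Continuous.intervalIntegrable (by fun_prop) _ _)]
    have hbd : ∀ y ∈ Set.Icc (x (i - 1)) (x i), |β * e₂ i y + γ * e₁ i y| ≤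
        |β| / α * (|β| * (K * (B * ω)) + γ * (K * (B * ω)) + |w i y|) + γ * (K * (B * ω)) := by
      intro y hy
      obtain ⟨p1, p2⟩ := hpt i hi y hy
      have heq : β * e₂ i y + γ * e₁ i y
          = β / α * (β * e₁ i y + γ * e i y - w i y) + γ * e₁ i y := by
        simp only [hw]; field_simp; ring
      rw [heq]
      refine (abs_add_le _ _).trans ?_
      rw [abs_mul, abs_div, abs_of_pos hα, abs_mul γ, abs_of_nonneg hγ]
      have h5 : |β * e₁ i y + γ * e i y - w i y| ≤
          |β| * (K * (B * ω)) + γ * (K * (B * ω)) + |w i y| := by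
        refine (abs_sub _ _).trans (add_le_add_left ((abs_add_le _ _).trans ?_) _)
        rw [abs_mul, abs_mul, abs_of_nonneg hγ]
        gcongr
      gcongr
    calc _ ≤ ∫ y in (x (i - 1))..t, |β * e₂ i y + γ * e₁ i y| :=
          abs_integral_le_integral_abs ht.1
      _ ≤ ∫ y in (x (i - 1))..(x i), |β * e₂ i y + γ * e₁ i y| :=
          intervalIntegral.integral_mono_interval le_rfl ht.1 ht.2
            (Filter.Eventually.of_forall fun _ => abs_nonneg _)
            (Continuous.intervalIntegrable (by fun_prop) _ _)
      _ ≤ ∫ y in (x (i - 1))..(x i), (|β| / α * |w i y| +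
            (|β| / α * (|β| * (K * (B * ω)) + γ * (K * (B * ω))) + γ * (K * (B * ω)))) :=
          intervalIntegral.integral_mono_on (hm.pos_step hi).le
            (Continuous.intervalIntegrable (by fun_prop) _ _)
            (Continuous.intervalIntegrable (by fun_prop) _ _)
            fun y hy => (hbd y hy).trans (le_of_eq (by ring))
      _ = |β| / α * (∫ y in (x (i - 1))..(x i), |w i y|) + (x i - x (i - 1)) *
            (|β| / α * (|β| * (K * (B * ω)) + γ * (K * (B * ω))) + γ * (K * (B * ω))) := by
          rw [intervalIntegral.integral_add, intervalIntegral.integral_const_mul,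
            intervalIntegral.integral_const, smul_eq_mul]
          all_goals exact Continuous.intervalIntegrable (by fun_prop) _ _
      _ ≤ |β| / α * (ω * (x i - x (i - 1))) + (x i - x (i - 1)) *
            (|β| / α * (|β| * (K * (B * ω)) + γ * (K * (B * ω))) + γ * (K * (B * ω))) := by
          gcongr
          exact hmean i hi
      _ = L * ω * (x i - x (i - 1)) := by rw [hL]; ring
  have hδ0 : 0 ≤ δ := by
    obtain ⟨q, -, hq⟩ := happrox i₀ hi₀
    exact (abs_nonneg _).trans (hq _ ⟨le_rfl, (hm.pos_step hi₀).le⟩)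
  have hh0 : 0 ≤ h := (hstep i₀ hi₀).le.trans (hh i₀ hi₀)
  have hωle : ω ≤ α * δ + L * ω * h := by
    obtain ⟨q, hqn, hq⟩ := happrox i₀ hi₀
    set l := x (i₀ - 1) with hl
    set Q : Polynomial ℝ :=
      Polynomial.C (-α) * q + Polynomial.C (β * e₁ i₀ l + γ * e i₀ l) with hQ
    have hQdeg : Q.natDegree ≤ n :=
      (Polynomial.natDegree_add_C).le.trans ((Polynomial.natDegree_C_mul_le _ _).trans hqn)
    have hsq := integral_sq_le_of_orthogonal (hcw i₀) Q.continuous (hm.pos_step hi₀).le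
      (horth i₀ hi₀ Q hQdeg) (m := α * δ + L * ω * h) fun t ht => by
        have heq : w i₀ t - Q.eval t = -α * (e₂ i₀ t - q.eval t) +
            ((β * e₁ i₀ t + γ * e i₀ t) - (β * e₁ i₀ l + γ * e i₀ l)) := by
          simp only [hw, hQ, Polynomial.eval_add, Polynomial.eval_mul, Polynomial.eval_C]
          ring
        rw [heq]
        refine (abs_add_le _ _).trans (add_le_add ?_ ((hosc i₀ hi₀ t ht).trans ?_))
        · rw [abs_mul, abs_neg, abs_of_pos hα]
          exact mul_le_mul_of_nonneg_left (hq t ht) hα.le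
        · exact mul_le_mul_of_nonneg_left (hh i₀ hi₀) (by positivity)
    rw [← div_le_iff₀ (hstep i₀ hi₀), ← hω2] at hsq
    exact (le_abs_self ω).trans (abs_le_of_sq_le_sq hsq (by positivity))
  have hω' : ω ≤ 2 * α * δ := by
    have h1 : L * h ≤ 1 / 2 := by nlinarith
    have h2 : L * ω * h ≤ 1 / 2 * ω := by
      calc L * ω * h = L * h * ω := by ring
        _ ≤ 1 / 2 * ω := by gcongr
    linarith
  intro i hi
  exact (hmean i hi).trans (mul_le_mul_of_nonneg_right hω' (hstep i hi).le)

/-- Duality estimate at the nodes: orthogonality of the residual to polynomials gains the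
approximation order of the smooth adjoint solutions. -/
lemma exists_nodal_bound {α β γ d : ℝ} (hα : 0 < α) (hγ : 0 ≤ γ) (hd : 0 < d) (n : ℕ) :
    ∃ K > 0, ∀ (a b : ℝ), b - a = d → ∀ (N : ℕ) (x : ℕ → ℝ), IsMesh a b N x →
      ∀ e e₁ e₂ : ℕ → ℝ → ℝ, IsBrokenC2 N x e e₁ e₂ → ∀ ω h : ℝ,
      (∀ i ∈ Finset.Icc 1 N, ∀ q : Polynomial ℝ, q.natDegree ≤ n →
        ∫ y in (x (i - 1))..(x i), (-α * e₂ i y + β * e₁ i y + γ * e i y) * q.eval y = 0) →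
      (∀ i ∈ Finset.Icc 1 N, x i - x (i - 1) ≤ h) →
      (∀ i ∈ Finset.Icc 1 N,
        ∫ y in (x (i - 1))..(x i), |-α * e₂ i y + β * e₁ i y + γ * e i y|
          ≤ ω * (x i - x (i - 1))) →
      ∀ i ∈ Finset.Icc 1 N,
        (|e i (x (i - 1))| ≤ K * (h ^ (n + 1) * ω) ∧ |e₁ i (x (i - 1))| ≤ K * (h ^ (n + 1) * ω)) ∧
        |e i (x i)| ≤ K * (h ^ (n + 1) * ω) ∧ |e₁ i (x i)| ≤ K * (h ^ (n + 1) * ω) := by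
  obtain ⟨ψ, φ, hψ, hφ, hW, hD⟩ := exists_adjoint_pair (β := β) hα hγ hd
  obtain ⟨K, hK, hstab⟩ := exists_moment_stability hα hd hψ hφ hW hD
  have hsmooth : ∀ χ : ℝ → ℝ, IsAdjointSol α β γ χ → ContDiff ℝ (n + 1) χ := fun χ hχ =>
    hχ.contDiff.of_le (by exact_mod_cast le_top)
  have hcont : ∀ χ : ℝ → ℝ, IsAdjointSol α β γ χ → Continuous (iteratedDeriv (n + 1) χ) :=
    fun χ hχ => (hsmooth χ hχ).continuous_iteratedDeriv' (n + 1)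
  obtain ⟨B, hB⟩ := (isCompact_Icc (a := (0 : ℝ)) (b := d)).exists_bound_of_continuousOn
    (f := fun t => (iteratedDeriv (n + 1) ψ t, iteratedDeriv (n + 1) φ t))
    ((hcont ψ hψ).prodMk (hcont φ hφ)).continuousOn
  have hB' : ∀ χ ∈ ({ψ, φ} : Set (ℝ → ℝ)), IsAdjointSol α β γ χ ∧
      ∀ t ∈ Set.Icc 0 d, |iteratedDeriv (n + 1) χ t| ≤ B := by
    intro χ hχ
    rcases hχ with rfl | rfl
    · exact ⟨hψ, fun t ht => (norm_fst_le _).trans (hB t ht)⟩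
    · exact ⟨hφ, fun t ht => (norm_snd_le _).trans (hB t ht)⟩
  have hB0 : 0 ≤ B := (abs_nonneg _).trans ((hB' ψ (by simp)).2 0 ⟨le_rfl, hd.le⟩)
  refine ⟨K * (B + 1), by positivity, fun a b hab N x hm e e₁ e₂ he ω h horth hh hmean => ?_⟩
  have hstep : ∀ i ∈ Finset.Icc 1 N, 0 < x i - x (i - 1) := fun i hi => sub_pos.2 (hm.pos_step hi)
  have hω0 : 0 ≤ ω := by
    have h1 : (1 : ℕ) ∈ Finset.Icc 1 N := Finset.mem_Icc.2 ⟨le_rfl, hm.1⟩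
    exact nonneg_of_mul_nonneg_left ((intervalIntegral.integral_nonneg (hm.pos_step h1).le
      fun _ _ => abs_nonneg _).trans (hmean 1 h1)) (hstep 1 h1)
  have hh0 : 0 ≤ h := by
    have h1 : (1 : ℕ) ∈ Finset.Icc 1 N := Finset.mem_Icc.2 ⟨le_rfl, hm.1⟩
    exact (hstep 1 h1).le.trans (hh 1 h1)
  set η := (B + 1) * (h ^ (n + 1) * ω) with hη
  have hη0 : 0 ≤ η := by positivity
  have hmom : ∀ χ ∈ ({ψ, φ} : Set (ℝ → ℝ)), ∀ i ∈ Finset.Icc 1 N,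
      |∫ y in (x (i - 1))..(x i), (-α * e₂ i y + β * e₁ i y + γ * e i y) * χ (y - a)|
        ≤ η * (x i - x (i - 1)) := by
    intro χ hχmem i hi
    obtain ⟨hχ, hχB⟩ := hB' χ hχmem
    obtain ⟨hi1, hiN⟩ := Finset.mem_Icc.1 hi
    have hl := (hm.mem_Icc (i := i - 1) (by omega)).1
    have hr := (hm.mem_Icc hiN).2
    obtain ⟨q, hqn, hq⟩ := exists_polynomial_approx (f := fun y => χ (y - a))
      ((hsmooth χ hχ).comp (contDiff_id.sub contDiff_const)) (hm.pos_step hi) (B := B)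
      fun y hy => by
        rw [iteratedDeriv_comp_sub_const]
        exact hχB _ ⟨by linarith [hy.1], by linarith [hy.2]⟩
    have hce : Continuous (e i) :=
      continuous_iff_continuousAt.2 fun y => (he.hasDerivAt i y).continuousAt
    have hce₁ : Continuous (e₁ i) :=
      continuous_iff_continuousAt.2 fun y => (he.hasDerivAt_deriv i y).continuousAt
    have hce₂ := he.continuous_deriv₂ i
    have hcχ := hχ.contDiff.continuous
    have hcq := q.continuous
    have hsplit : ∫ y in (x (i - 1))..(x i), (-α * e₂ i y + β * e₁ i y + γ * e i y) * χ (y - a)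
        = ∫ y in (x (i - 1))..(x i),
          (-α * e₂ i y + β * e₁ i y + γ * e i y) * (χ (y - a) - q.eval y) := by
      simp_rw [mul_sub]
      rw [intervalIntegral.integral_sub, horth i hi q hqn, sub_zero]
      all_goals exact Continuous.intervalIntegrable (by fun_prop) _ _
    rw [hsplit]
    calc _ ≤ _ := integral_abs_mul_le (by fun_prop) (by fun_prop) (hm.pos_step hi).le hq
      _ ≤ B * h ^ (n + 1) * (ω * (x i - x (i - 1))) := by
        have := (hstep i hi).le
        gcongr
        · exact intervalIntegral.integral_nonneg (hm.pos_step hi).le fun _ _ => abs_nonneg _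
        · exact hh i hi
        · exact hmean i hi
      _ ≤ (B + 1) * h ^ (n + 1) * (ω * (x i - x (i - 1))) := by
        have := (hstep i hi).le
        gcongr
        linarith
      _ = η * (x i - x (i - 1)) := by rw [hη]; ring
  intro i hi
  have hle := (hm.pos_step hi).le
  have hl := hstab a b hab N x hm e e₁ e₂ he η hmom i hi (x (i - 1)) ⟨le_rfl, hle⟩
    fun χ _ => by
      rw [intervalIntegral.integral_same, abs_zero]
      exact mul_nonneg hη0 (hstep i hi).le
  have hr := hstab a b hab N x hm e e₁ e₂ he η hmom i hi (x i) ⟨hle, le_rfl⟩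
    fun χ hχ => hmom χ hχ i hi
  rw [hη, ← mul_assoc] at hl hr
  exact ⟨hl, hr⟩

/-- The elementwise error of a Petrov–Galerkin solution is a broken `C²` function. -/
lemma IsVh0.isBrokenC2_error {a b : ℝ} {k N : ℕ} {x : ℕ → ℝ} {P : ℕ → Polynomial ℝ}
    (hP : IsVh0 k N x P) (hm : IsMesh a b N x) {u : ℝ → ℝ} (hu : ContDiff ℝ 2 u) (hua : u a = 0)
    (hub : u b = 0) :
    IsBrokenC2 N x (fun i t => u t - (P i).eval t)
      (fun i t => deriv u t - (Polynomial.derivative (P i)).eval t)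
      (fun i t => iteratedDeriv 2 u t -
        (Polynomial.derivative (Polynomial.derivative (P i))).eval t) where
  hasDerivAt i t := ((hu.differentiable (by simp)) t).hasDerivAt.sub ((P i).hasDerivAt t)
  hasDerivAt_deriv i t := by
    rw [iteratedDeriv_succ, iteratedDeriv_one]
    exact (hu.differentiable_deriv_two t).hasDerivAt.sub ((Polynomial.derivative (P i)).hasDerivAt t)
  continuous_deriv₂ i := (hu.continuous_iteratedDeriv' 2).sub (Polynomial.continuous _)
  value_match i hi := by rw [hP.2.1 i hi]
  deriv_match i hi := by rw [hP.2.2.1 i hi]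
  left_zero := by rw [hP.2.2.2.1, hm.2.1, hua, sub_zero]
  right_zero := by rw [hP.2.2.2.2, hm.2.2.1, hub, sub_zero]

/-- Galerkin orthogonality, localized to one element. -/
lemma IsPGSol.orthogonal {k N : ℕ} {x : ℕ → ℝ} {α β γ : ℝ} {u : ℝ → ℝ} {P : ℕ → Polynomial ℝ}
    (hu : ContDiff ℝ 2 u)
    (hP : IsPGSol k N x α β γ (fun t => -α * iteratedDeriv 2 u t + β * deriv u t + γ * u t) P)
    {i : ℕ} (hi : i ∈ Finset.Icc 1 N) {q : Polynomial ℝ} (hq : q.natDegree ≤ k - 2) :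
    ∫ y in (x (i - 1))..(x i), (-α * (iteratedDeriv 2 u y -
        (Polynomial.derivative (Polynomial.derivative (P i))).eval y) +
      β * (deriv u y - (Polynomial.derivative (P i)).eval y) + γ * (u y - (P i).eval y)) *
        q.eval y = 0 := by
  have h := hP.2 (fun j => if j = i then q else 0) fun j _ => by
    split_ifs
    · exact hq
    · simp
  rw [Finset.sum_eq_single_of_mem i hi (fun j _ hj => by simp [hj]),
    Finset.sum_eq_single_of_mem i hi (fun j _ hj => by simp [hj])] at h
  simp only [if_true] at h
  have hc0 := hu.continuous
  have hc1 := hu.continuous_deriv (by simp)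
  have hc2 := hu.continuous_iteratedDeriv' 2
  have hp0 := (P i).continuous
  have hp1 := (Polynomial.derivative (P i)).continuous
  have hp2 := (Polynomial.derivative (Polynomial.derivative (P i))).continuous
  have hcq := q.continuous
  rw [← sub_eq_zero.2 h.symm, ← intervalIntegral.integral_sub]
  · exact intervalIntegral.integral_congr fun y _ => by ring
  all_goals exact Continuous.intervalIntegrable (by fun_prop) _ _

/-- Superconvergence of the Petrov–Galerkin solution at the mesh nodes: both
`|(u - u_h)(x_i)|` and `|(u - u_h)'(x_i)|` are bounded by `C h^{2(k-1)} |u|_{k+1,∞}`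
at every node `x_i`, `i = 0, …, N`. -/
theorem petrov_galerkin_superconvergence_at_nodes (k : ℕ) (hk : 3 ≤ k)
    (α β γ c d : ℝ) (hα : 0 < α) (hγ : 0 ≤ γ) (hc : 1 ≤ c) (hd : 0 < d) :
    ∃ C > 0, ∃ h₀ > 0, ∀ (a b : ℝ), b - a = d →
      ∀ (N : ℕ) (x : ℕ → ℝ) (h : ℝ),
        IsMesh a b N x → IsMeshSize N x h → IsQuasiUniform N x h c → h ≤ h₀ →
      ∀ u : ℝ → ℝ, ContDiff ℝ (k + 1) u → u a = 0 → u b = 0 →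
      ∀ P : ℕ → Polynomial ℝ,
        IsPGSol k N x α β γ (fun t => -α * iteratedDeriv 2 u t + β * deriv u t + γ * u t) P →
      ∀ M : ℝ, (∀ y ∈ Set.Ioo a b, |iteratedDeriv (k + 1) u y| ≤ M) →
        ∀ i ∈ Finset.Icc 1 N,
          |u (x (i - 1)) - (P i).eval (x (i - 1))| ≤ C * h ^ (2 * (k - 1)) * M ∧
          |u (x i) - (P i).eval (x i)| ≤ C * h ^ (2 * (k - 1)) * M ∧
          |deriv u (x (i - 1)) - (Polynomial.derivative (P i)).eval (x (i - 1))|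
            ≤ C * h ^ (2 * (k - 1)) * M ∧
          |deriv u (x i) - (Polynomial.derivative (P i)).eval (x i)|
            ≤ C * h ^ (2 * (k - 1)) * M := by
  obtain ⟨n, rfl⟩ : ∃ n, k = n + 2 := ⟨k - 2, by omega⟩
  obtain ⟨K₁, hK₁, hres⟩ := exists_residual_bound (β := β) hα hγ hd
  obtain ⟨K₂, hK₂, hnode⟩ := exists_nodal_bound (β := β) hα hγ hd n
  refine ⟨K₂ * (2 * α), by positivity, 1 / (2 * K₁), by positivity, ?_⟩
  intro a b hab N x h hm hsize _ hh u hu hua hub P hP M hM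
  have hu2 : ContDiff ℝ 2 u := hu.of_le (by norm_cast; omega)
  have he := hP.1.isBrokenC2_error hm hu2 hua hub
  have horth := fun i (hi : i ∈ Finset.Icc 1 N) (q : Polynomial ℝ) (hq : q.natDegree ≤ n) =>
    hP.orthogonal hu2 hi (q := q) (by simpa using hq)
  have hM' : ∀ y ∈ Set.Icc a b, |iteratedDeriv (n + 2 + 1) u y| ≤ M := by
    have hcont : Continuous (iteratedDeriv (n + 2 + 1) u) := by
      refine hu.continuous_iteratedDeriv _ ?_
      norm_cast
    have hclosed : IsClosed {y | |iteratedDeriv (n + 2 + 1) u y| ≤ M} :=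
      isClosed_le hcont.abs continuous_const
    rw [← closure_Ioo (by linarith : a ≠ b)]
    exact closure_minimal hM hclosed
  have hM0 : 0 ≤ M := (abs_nonneg _).trans (hM' a ⟨le_rfl, by linarith⟩)
  have hiter : iteratedDeriv (n + 1) (iteratedDeriv 2 u) = iteratedDeriv (n + 2 + 1) u := by
    simp only [iteratedDeriv_eq_iterate, ← Function.iterate_add_apply]
  have happrox : ∀ i ∈ Finset.Icc 1 N, ∃ q : Polynomial ℝ, q.natDegree ≤ n ∧
      ∀ t ∈ Set.Icc (x (i - 1)) (x i), |iteratedDeriv 2 u t -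
        (Polynomial.derivative (Polynomial.derivative (P i))).eval t - q.eval t|
          ≤ M * h ^ (n + 1) := by
    intro i hi
    obtain ⟨hi1, hiN⟩ := Finset.mem_Icc.1 hi
    have hsmooth : ContDiff ℝ (n + 1) (iteratedDeriv 2 u) := by
      rw [iteratedDeriv_eq_iterate]
      refine ContDiff.iterate_deriv' (n + 1) 2 (hu.of_le ?_)
      norm_cast
    obtain ⟨q, hqn, hq⟩ := exists_polynomial_approx hsmooth (hm.pos_step hi) (B := M)
      fun y hy => by
        rw [hiter]
        exact hM' y ⟨(hm.mem_Icc (i := i - 1) (by omega)).1.trans hy.1,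
          hy.2.trans (hm.mem_Icc hiN).2⟩
    refine ⟨q - Polynomial.derivative (Polynomial.derivative (P i)), ?_, fun t ht => ?_⟩
    · refine (Polynomial.natDegree_sub_le_of_le hqn ?_).trans (max_self n).le
      have h1 := Polynomial.natDegree_derivative_le (P i)
      have h2 := Polynomial.natDegree_derivative_le (Polynomial.derivative (P i))
      have h3 := hP.1.1 i hi
      omega
    · rw [Polynomial.eval_sub, sub_sub_sub_cancel_right]
      refine (hq t ht).trans ?_
      have := sub_pos.2 (hm.pos_step hi)
      gcongr
      exact hsize.1 i hi
  have hKh : K₁ * h ≤ 1 / 2 := by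
    rw [le_div_iff₀ (by positivity)] at hh
    linarith
  intro i hi
  have := hnode a b hab N x hm _ _ _ he _ h horth hsize.1
    (hres a b hab N x hm _ _ _ he n _ h horth happrox hsize.1 hKh) i hi
  have hC : K₂ * (h ^ (n + 1) * (2 * α * (M * h ^ (n + 1))))
      = K₂ * (2 * α) * h ^ (2 * (n + 2 - 1)) * M := by
    rw [show 2 * (n + 2 - 1) = (n + 1) + (n + 1) by omega, pow_add]
    ring
  rw [hC] at this
  exact ⟨this.1.1, this.2.1, this.1.2, this.2.2⟩
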